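/- For α > -1, c > 0, and any real s > n with s + α > 0, the function Q̃_n^{(α,c)}(x) := (d^n/dx^n)[x^{(α+n)/2} e^{-cx} I_{α+n}(2√x)] satisfies ∫_0^∞ x^{s-1} Q̃_n^{(α,c)}(x) dx = (-1)^n e^{1/c} Γ(s) Γ(s+α) / (c^{s+α} Γ(n+α+1) Γ(s-n)) · ₁F₁(n-s+1; α+n+1; -1/c). -/

import Mathlib

noncomputable def besselI (ν z : ℝ) : ℝ :=
  (z / 2) ^ ν * ∑' i : ℕ, (z ^ 2 / 4) ^ i / (Real.Gamma (i + 1) * Real.Gamma (ν + i + 1))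

/-- The weight `w_{v,c}(x) = x^{v/2} e^{-c x} I_v(2√x)`. -/
noncomputable def wBessel (v c x : ℝ) : ℝ :=
  x ^ (v / 2) * Real.exp (-c * x) * besselI v (2 * Real.sqrt x)
/-- `Q̃_n^{(α,c)}(x) = (d^n/dx^n) w_{α+n,c}(x)`. -/
noncomputable def Qt (n : ℕ) (α c x : ℝ) : ℝ :=
  iteratedDeriv n (fun y => wBessel (α + n) c y) x
/-- Rising factorial (Pochhammer symbol) `(a)_k`. -/
noncomputable def risingFactorial (a : ℝ) (k : ℕ) : ℝ := ∏ i ∈ Finset.range k, (a + i)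

/-- Confluent hypergeometric function `₁F₁(a;b;z)`. -/
noncomputable def hyp1F1 (a b z : ℝ) : ℝ :=
  ∑' j : ℕ, risingFactorial a j * z ^ j / (risingFactorial b j * Nat.factorial j)


open Real Set Filter Topology MeasureTheory

lemma rf_zero (a : ℝ) : risingFactorial a 0 = 1 := by simp [risingFactorial]

lemma rf_succ (a : ℝ) (k : ℕ) : risingFactorial a (k+1) = risingFactorial a k * (a + k) := by
  simp [risingFactorial, Finset.prod_range_succ]

lemma rf_succ' (a : ℝ) (k : ℕ) : risingFactorial a (k+1) = a * risingFactorial (a+1) k := by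
  simp only [risingFactorial, Finset.prod_range_succ', mul_comm a]
  congr 1
  · apply Finset.prod_congr rfl
    intro i _
    push_cast; ring
  · simp

lemma rf_pos {a : ℝ} (ha : 0 < a) (k : ℕ) : 0 < risingFactorial a k :=
  Finset.prod_pos fun i _ => by positivity

lemma gamma_rf {a : ℝ} (ha : 0 < a) (k : ℕ) :
    Gamma (a + k) = Gamma a * risingFactorial a k := by
  induction k with
  | zero => simp [rf_zero]
  | succ k ih =>
    have : a + k ≠ 0 := by positivity
    rw [Nat.cast_succ, ← add_assoc, Gamma_add_one this, ih, rf_succ]; ring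

lemma chu (i : ℕ) : ∀ a b : ℝ, 0 < b →
    ∑ p ∈ Finset.HasAntidiagonal.antidiagonal i, (i.choose p.1 : ℝ) *
      ((-1)^p.1 * risingFactorial (b-a) p.1 / risingFactorial b p.1)
      = risingFactorial a i / risingFactorial b i := by
  induction i with
  | zero => intro a b hb; simp [rf_zero]
  | succ i ih =>
    intro a b hb
    rw [Finset.sum_antidiagonal_choose_succ_mul
      (fun k _ => (-1)^k * risingFactorial (b-a) k / risingFactorial b k),
      ← Finset.sum_add_distrib, rf_succ' a, rf_succ' b, mul_div_mul_comm,
      ← ih (a+1) (b+1) (by positivity), Finset.mul_sum]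
    apply Finset.sum_congr rfl
    rintro ⟨k, l⟩ hkl
    have hkl' : k + l = i := by simpa using hkl
    have hch : i.choose l = i.choose k := by
      rw [← hkl', Nat.choose_symm_add]
    have h1 := rf_succ' b k
    have h2 := rf_succ b k
    have p1 := (rf_pos hb k).ne'
    have p2 := (rf_pos (show 0 < b+1 by positivity) k).ne'
    have p3 : b + k ≠ 0 := by positivity
    have h3 : risingFactorial (b+1) k = risingFactorial b k * (b+k) / b := by
      rw [← h2, h1]; field_simp
    simp only [hch, rf_succ, h3]
    rw [show b + 1 - (a+1) = b - a by ring]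
    field_simp
    ring

lemma hyp_summable (a : ℝ) {b : ℝ} (hb : 0 < b) (z : ℝ) :
    Summable fun j : ℕ => risingFactorial a j * z ^ j / (risingFactorial b j * Nat.factorial j) := by
  apply summable_of_ratio_norm_eventually_le (r := 1/2) (by norm_num)
  obtain ⟨N, hN⟩ := exists_nat_gt (2 * (|a| / b + 1) * |z|)
  filter_upwards [eventually_ge_atTop N] with j hj
  have hj' : (N:ℝ) ≤ j := by exact_mod_cast hj
  have e : risingFactorial a (j+1) * z ^ (j+1) / (risingFactorial b (j+1) * Nat.factorial (j+1))
     = ((a + j) / (b+j) * z / (j+1)) * (risingFactorial a j * z ^ j / (risingFactorial b j * Nat.factorial j)) := by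
    have p1 := (rf_pos hb j).ne'
    have p3 : b + j ≠ 0 := by positivity
    rw [rf_succ, rf_succ, Nat.factorial_succ]
    push_cast
    field_simp
    ring
  rw [e, norm_mul]
  gcongr
  rw [norm_div, norm_mul, norm_eq_abs, norm_eq_abs, norm_eq_abs, abs_of_pos (show (0:ℝ) < j+1 by positivity),
    div_le_iff₀ (by positivity)]
  have : |(a + j) / (b+j)| ≤ |a| / b + 1 := by
    rw [abs_div, abs_of_pos (show 0 < b + j by positivity), div_le_iff₀ (by positivity)]
    calc |a + j| ≤ |a| + j := by simpa using abs_add_le a (j:ℝ)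
      _ ≤ |a| + j + (|a|/b*j + b) := by have : 0 ≤ |a|/b*j + b := by positivity
                                        linarith
      _ = _ := by field_simp; ring
  nlinarith [mul_le_mul_of_nonneg_right this (abs_nonneg z)]

lemma kummer (a : ℝ) {b : ℝ} (hb : 0 < b) (z : ℝ) :
    hyp1F1 a b z = exp z * hyp1F1 (b-a) b (-z) := by
  unfold hyp1F1
  rw [mul_comm, Real.exp_eq_exp_ℝ, NormedSpace.exp_eq_tsum_div,
    tsum_mul_tsum_eq_tsum_sum_antidiagonal_of_summable_norm
    (hyp_summable (b-a) hb (-z)).norm (Real.summable_pow_div_factorial z).norm]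
  apply tsum_congr
  intro i
  rw [mul_div_mul_comm, ← chu i a b hb, Finset.sum_mul]
  apply Finset.sum_congr rfl
  rintro ⟨k, l⟩ hkl
  have hkl' : k + l = i := by simpa using hkl
  subst hkl'
  have p1 := (rf_pos hb k).ne'
  have hc : ((k+l).choose k : ℝ) = (k+l).factorial / (k.factorial * l.factorial) := by
    rw [Nat.cast_add_choose]
  have f1 : ((k+l).factorial : ℝ) ≠ 0 := by positivity
  simp only [hc]
  rw [neg_pow z, pow_add]
  field_simp

noncomputable def gser (ν x : ℝ) : ℝ := ∑' i : ℕ, x ^ i / (Gamma (i + 1) * Gamma (ν + i + 1))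

lemma gam_pos {ν : ℝ} (hν : -1 < ν) (i : ℕ) : 0 < Gamma (ν + i + 1) := by
  apply Gamma_pos_of_pos
  have : (0:ℝ) ≤ i := by positivity
  linarith

lemma inv_gamma_bound {ν : ℝ} (hν : -1 < ν) {ε : ℝ} (hε : 0 < ε) :
    ∃ K, 0 < K ∧ ∀ i : ℕ, 1 / Gamma (ν + i + 1) ≤ K * ε ^ i := by
  have h : Summable fun i : ℕ => (1/ε)^i / Gamma (ν + i + 1) := by
    apply summable_of_ratio_norm_eventually_le (r := 1/2) (by norm_num)
    obtain ⟨N, hN⟩ := exists_nat_gt (2 / ε)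
    filter_upwards [eventually_ge_atTop (N+1)] with j hj
    have hj' : (N:ℝ) + 1 ≤ j := by exact_mod_cast hj
    have hp := gam_pos hν j
    have hν' : 0 < ν + j + 1 := by
      have : (0:ℝ) ≤ j := by positivity
      linarith
    rw [norm_of_nonneg (div_nonneg (by positivity) (gam_pos hν _).le),
      norm_of_nonneg (div_nonneg (by positivity) (gam_pos hν _).le)]
    rw [show ν + ((j+1 : ℕ):ℝ) + 1 = (ν + j + 1) + 1 by push_cast; ring, Gamma_add_one hν'.ne', pow_succ]
    have : 1/ε * (1/(ν + j + 1)) ≤ 1/2 := by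
      rw [div_mul_div_comm, div_le_div_iff₀ (by positivity) (by norm_num)]
      have : 2 / ε < ν + j + 1 := by linarith
      rw [div_lt_iff₀ hε] at this
      linarith
    calc _ = (1/ε * (1/(ν + j + 1))) * ((1/ε)^j / Gamma (ν + j + 1)) := by field_simp
      _ ≤ _ := by gcongr
  obtain ⟨K, hK⟩ := h.tendsto_atTop_zero.bddAbove_range
  refine ⟨max K 1, by positivity, fun i => ?_⟩
  have h1 : (1/ε)^i / Gamma (ν + i + 1) ≤ K := hK ⟨i, rfl⟩
  have hp := gam_pos hν i
  calc 1 / Gamma (ν + i + 1) = (1/ε)^i / Gamma (ν + i + 1) * ε^i := by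
        rw [div_pow, one_pow]; field_simp
    _ ≤ _ := by gcongr; exact h1.trans (le_max_left _ _)

lemma term_bound {ν : ℝ} (hν : -1 < ν) {ε K : ℝ}
    (hK : ∀ i : ℕ, 1 / Gamma (ν + i + 1) ≤ K * ε ^ i) (x : ℝ) (i : ℕ) :
    ‖x ^ i / (Gamma (i + 1) * Gamma (ν + i + 1))‖ ≤ K * ((ε * |x|) ^ i / i.factorial) := by
  have hp := gam_pos hν i
  rw [Gamma_nat_eq_factorial, norm_div, norm_of_nonneg (show 0 ≤ (i.factorial : ℝ) * Gamma (ν + i + 1) by positivity),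
    norm_pow, norm_eq_abs]
  calc |x|^i / (i.factorial * Gamma (ν + i + 1)) = |x|^i / i.factorial * (1 / Gamma (ν + i + 1)) := by
        field_simp
    _ ≤ |x|^i / i.factorial * (K * ε ^ i) := by gcongr; exact hK i
    _ = _ := by rw [mul_pow]; ring

lemma gser_summable {ν : ℝ} (hν : -1 < ν) (x : ℝ) :
    Summable fun i : ℕ => x ^ i / (Gamma (i + 1) * Gamma (ν + i + 1)) := by
  obtain ⟨K, -, hK⟩ := inv_gamma_bound hν one_pos
  exact Summable.of_norm_bounded ((Real.summable_pow_div_factorial _).mul_left K) (term_bound hν hK x)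

lemma gser_bound {ν : ℝ} (hν : -1 < ν) {ε : ℝ} (hε : 0 < ε) :
    ∃ K, 0 < K ∧ ∀ x, |gser ν x| ≤ K * exp (ε * |x|) := by
  obtain ⟨K, hK0, hK⟩ := inv_gamma_bound hν hε
  refine ⟨K, hK0, fun x => ?_⟩
  rw [Real.exp_eq_exp_ℝ, NormedSpace.exp_eq_tsum_div, ← tsum_mul_left]
  exact tsum_of_norm_bounded ((Real.summable_pow_div_factorial _).mul_left K).hasSum (term_bound hν hK x)

lemma dterm (ν x : ℝ) (i : ℕ) : ((i+1 : ℕ):ℝ) * x ^ (i+1-1) / (Gamma ((i+1:ℕ) + 1) * Gamma (ν + (i+1:ℕ) + 1))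
    = x ^ i / (Gamma (i + 1) * Gamma (ν + 1 + i + 1)) := by
  rw [Gamma_nat_eq_factorial, Gamma_nat_eq_factorial, Nat.factorial_succ,
    show ν + ((i+1:ℕ):ℝ) + 1 = ν + 1 + i + 1 by push_cast; ring, Nat.add_sub_cancel]
  push_cast
  have : (i:ℝ) + 1 ≠ 0 := by positivity
  rw [mul_assoc, mul_div_mul_left _ _ this]

lemma dsummable {ν : ℝ} (hν : -1 < ν) (x : ℝ) : Summable fun i : ℕ =>
    (i:ℝ) * x ^ (i-1) / (Gamma (i + 1) * Gamma (ν + i + 1)) := by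
  rw [← summable_nat_add_iff 1]
  simp only [dterm]
  exact gser_summable (by linarith) x

lemma gser_deriv {ν : ℝ} (hν : -1 < ν) (x : ℝ) : HasDerivAt (gser ν) (gser (ν+1) x) x := by
  have h := hasDerivAt_tsum_of_isPreconnected
    (g := fun (i:ℕ) (x:ℝ) => x ^ i / (Gamma (i + 1) * Gamma (ν + i + 1)))
    (g' := fun (i:ℕ) (x:ℝ) => (i:ℝ) * x ^ (i-1) / (Gamma (i + 1) * Gamma (ν + i + 1)))
    (t := Metric.ball 0 (|x|+1)) (y₀ := x) (y := x)
    (dsummable hν (|x|+1)) Metric.isOpen_ball (convex_ball _ _).isPreconnected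
    (fun i y _ => (hasDerivAt_pow i y).div_const _)
    (fun i y hy => by
      have hp := gam_pos hν i
      have hp' := gam_pos (show (-1:ℝ) < 0 by norm_num) i
      rw [zero_add] at hp'
      rw [norm_div, norm_of_nonneg (show 0 ≤ Gamma (i + 1) * Gamma (ν + i + 1) by positivity),
        norm_mul, norm_pow, norm_of_nonneg (Nat.cast_nonneg i)]
      have hy' : ‖y‖ ≤ |x| + 1 := by
        have := mem_ball_zero_iff.1 hy
        exact this.le
      gcongr)
    (by simp) (gser_summable hν x) (by simp)
  refine HasDerivAt.congr_deriv (f := gser ν) h ?_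
  rw [(dsummable hν x).tsum_eq_zero_add]
  simp only [dterm]
  simp [gser]

lemma gser_rec {ν : ℝ} (hν : 0 < ν) (x : ℝ) :
    ν * gser ν x + x * gser (ν+1) x = gser (ν-1) x := by
  have h1 := dsummable (show -1 < ν by linarith) x
  have e : gser (ν+1) x = ∑' i : ℕ, (i:ℝ) * x ^ (i-1) / (Gamma (i + 1) * Gamma (ν + i + 1)) := by
    rw [h1.tsum_eq_zero_add]
    simp only [dterm]
    simp [gser]
  rw [e]
  unfold gser
  rw [← tsum_mul_left, ← tsum_mul_left, ← ((gser_summable (by linarith) x).mul_left ν).tsum_add (h1.mul_left x)]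
  apply tsum_congr
  intro i
  have hp := gam_pos (show -1 < ν - 1 by linarith) i
  have h0 : ν + i ≠ 0 := by positivity
  rw [Gamma_add_one h0]
  have : ν - 1 + i + 1 = ν + i := by ring
  rw [this] at hp ⊢
  have hp' := gam_pos (show (-1:ℝ) < 0 by norm_num) i
  rw [zero_add] at hp'
  have : x * ((i:ℝ) * x ^ (i-1) / (Gamma (i + 1) * ((ν + i) * Gamma (ν + i)))) =
    (i:ℝ) * x ^ i / (Gamma (i + 1) * ((ν + i) * Gamma (ν + i))) := by
    rcases i with _ | i
    · simp
    · simp only [Nat.add_sub_cancel, pow_succ]; ring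
  rw [this]
  field_simp

noncomputable def EE (c ν x : ℝ) : ℝ := x ^ ν * exp (-c * x) * gser ν x

lemma wBessel_eq (v c : ℝ) {x : ℝ} (hx : 0 < x) : wBessel v c x = EE c v x := by
  unfold wBessel besselI EE gser
  have h1 : 2 * √x / 2 = x ^ (1/2 : ℝ) := by rw [Real.sqrt_eq_rpow]; ring
  have h2 : (2 * √x)^2/4 = x := by rw [mul_pow, Real.sq_sqrt hx.le]; ring
  rw [h1, h2, ← Real.rpow_mul hx.le]
  have : x ^ v = x ^ (v/2) * x ^ (1/2 * v) := by rw [← Real.rpow_add hx]; congr 1; ring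
  rw [this]; ring

lemma EE_deriv (c : ℝ) {ν : ℝ} (hν : 0 < ν) {x : ℝ} (hx : 0 < x) :
    HasDerivAt (EE c ν) (EE c (ν-1) x - c * EE c ν x) x := by
  have h1 := Real.hasDerivAt_rpow_const (x := x) (p := ν) (Or.inl hx.ne')
  have h2 : HasDerivAt (fun x => exp (-c * x)) (exp (-c*x) * (-c * 1)) x :=
    ((hasDerivAt_id x).const_mul (-c)).exp
  have h3 := gser_deriv (show -1 < ν by linarith) x
  refine ((h1.mul h2).mul h3).congr_deriv ?_
  unfold EE
  rw [← gser_rec hν, Real.rpow_sub_one hx.ne']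
  simp only [Pi.mul_apply]
  field_simp
  ring

noncomputable def VV (c α : ℝ) : Submodule ℝ (ℝ → ℝ) :=
  Submodule.span ℝ (Set.range fun k : ℕ => EE c (α + k))

lemma EE_mem (c α : ℝ) (k : ℕ) : EE c (α + k) ∈ VV c α := Submodule.subset_span ⟨k, rfl⟩

lemma VV_deriv {c α : ℝ} (hα : -1 < α) {f : ℝ → ℝ} (hf : f ∈ VV c (α+1)) :
    ∃ f' ∈ VV c α, ∀ x, 0 < x → HasDerivAt f (f' x) x := by
  induction hf using Submodule.span_induction with
  | mem f h =>
    obtain ⟨k, rfl⟩ := h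
    refine ⟨EE c (α + k) - c • EE c (α + (k+1:ℕ)), 
      Submodule.sub_mem _ (EE_mem c α k) (Submodule.smul_mem _ _ (EE_mem c α _)), fun x hx => ?_⟩
    have := EE_deriv c (ν := α + 1 + k) (by have : (0:ℝ) ≤ k := by positivity
                                            linarith) hx
    convert this using 1
    rw [show α + (k+1:ℕ) = α + 1 + k by push_cast; ring, show α + 1 + k - 1 = α + k by ring]
    simp
  | zero => exact ⟨0, zero_mem _, fun x _ => hasDerivAt_const x 0⟩
  | add f g _ _ hf hg =>
    obtain ⟨f', h1, h2⟩ := hf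
    obtain ⟨g', h3, h4⟩ := hg
    exact ⟨f' + g', add_mem h1 h3, fun x hx => (h2 x hx).add (h4 x hx)⟩
  | smul a f _ hf =>
    obtain ⟨f', h1, h2⟩ := hf
    exact ⟨a • f', Submodule.smul_mem _ _ h1, fun x hx => (h2 x hx).const_smul a⟩

lemma Qt_succ (n : ℕ) (α c x : ℝ) : Qt (n+1) α c x = deriv (Qt n (α+1) c) x := by
  unfold Qt
  rw [iteratedDeriv_succ, show α + ((n+1:ℕ):ℝ) = α + 1 + n by push_cast; ring]

lemma Qt_mem (n : ℕ) (c : ℝ) : ∀ α : ℝ, -1 < α → ∃ f ∈ VV c α, ∀ x, 0 < x → Qt n α c x = f x := by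
  induction n with
  | zero =>
    intro α _
    refine ⟨_, EE_mem c α 0, fun x hx => ?_⟩
    simp [Qt, wBessel_eq _ _ hx]
  | succ n ih =>
    intro α hα
    obtain ⟨f, hf, h⟩ := ih (α+1) (by linarith)
    obtain ⟨f', hf', h'⟩ := VV_deriv hα hf
    refine ⟨f', hf', fun x hx => ?_⟩
    rw [Qt_succ, ← (h' x hx).deriv]
    apply Filter.EventuallyEq.deriv_eq
    filter_upwards [Ioi_mem_nhds hx] with y hy using h y hy

lemma EE_bound {c ν : ℝ} (hc : 0 < c) (hν : -1 < ν) (p : ℝ) : ∃ K, 0 < K ∧ ∀ x, 0 < x →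
    ‖x ^ p * EE c ν x‖ ≤ K * (x ^ (p + ν) * exp (-(c/2) * x)) := by
  obtain ⟨K, hK, h⟩ := gser_bound hν (show 0 < c/2 by positivity)
  refine ⟨K, hK, fun x hx => ?_⟩
  unfold EE
  have := h x
  rw [abs_of_pos hx] at this
  rw [norm_mul, norm_mul, norm_mul, norm_eq_abs (gser _ _), norm_of_nonneg (by positivity), norm_of_nonneg (by positivity),
    norm_of_nonneg (by positivity), Real.rpow_add hx]
  calc _ ≤ x ^ p * (x ^ ν * exp (-c * x) * (K * exp (c/2*x))) := by gcongr
    _ = K * (x^p * x^ν * (exp (-c*x) * exp (c/2*x))) := by ring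
    _ = _ := by rw [← Real.exp_add]; congr 4; ring

lemma EE_int {c ν : ℝ} (hc : 0 < c) (hν : -1 < ν) {p : ℝ} (hp : -1 < p + ν) :
    IntegrableOn (fun x => x ^ p * EE c ν x) (Ioi 0) := by
  obtain ⟨K, hK, h⟩ := EE_bound hc hν p
  have hi := integrableOn_rpow_mul_exp_neg_mul_rpow hp one_pos (show 0 < c/2 by positivity)
  simp only [Real.rpow_one] at hi
  refine Integrable.mono' (hi.const_mul K) ?_ ?_
  · apply Measurable.aestronglyMeasurable
    have : Measurable (gser ν) :=
      (continuous_iff_continuousAt.2 fun x => (gser_deriv hν x).continuousAt).measurable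
    unfold EE
    fun_prop
  · filter_upwards [ae_restrict_mem measurableSet_Ioi] with x hx using h x hx

lemma VV_int {c α : ℝ} (hc : 0 < c) (hα : -1 < α) {p : ℝ} (hp : -1 < p + α) {f : ℝ → ℝ} (hf : f ∈ VV c α) :
    IntegrableOn (fun x => x ^ p * f x) (Ioi 0) := by
  induction hf using Submodule.span_induction with
  | mem f h =>
    obtain ⟨k, rfl⟩ := h
    have : (0:ℝ) ≤ k := by positivity
    exact EE_int hc (by linarith) (by linarith)
  | zero => simp
  | add f g _ _ hf hg =>
    refine (Integrable.add hf hg).congr (ae_of_all _ fun x => ?_)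
    simp [mul_add]
  | smul a f _ hf =>
    refine (Integrable.const_mul hf a).congr (ae_of_all _ fun x => ?_)
    simp [mul_left_comm]

lemma VV_top {c α : ℝ} (hc : 0 < c) (hα : -1 < α) {p : ℝ} {f : ℝ → ℝ} (hf : f ∈ VV c α) :
    Tendsto (fun x => x ^ p * f x) atTop (𝓝 0) := by
  induction hf using Submodule.span_induction with
  | mem f h =>
    obtain ⟨k, rfl⟩ := h
    have : (0:ℝ) ≤ k := by positivity
    obtain ⟨K, hK, h⟩ := EE_bound hc (show -1 < α + k by linarith) p
    have h2 := (tendsto_rpow_mul_exp_neg_mul_atTop_nhds_zero (p + (α+k)) (c/2) (by positivity)).const_mul K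
    rw [mul_zero] at h2
    refine squeeze_zero_norm' ?_ h2
    filter_upwards [eventually_gt_atTop 0] with x hx using h x hx
  | zero => simp
  | add f g _ _ hf hg => simpa [mul_add] using hf.add hg
  | smul a f _ hf => simpa [mul_left_comm] using hf.const_mul a

lemma VV_zero {c α : ℝ} (hc : 0 < c) (hα : -1 < α) {p : ℝ} (hp : 0 < p + α) {f : ℝ → ℝ} (hf : f ∈ VV c α) :
    Tendsto (fun x => x ^ p * f x) (𝓝[>] 0) (𝓝 0) := by
  induction hf using Submodule.span_induction with
  | mem f h =>
    obtain ⟨k, rfl⟩ := h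
    have : (0:ℝ) ≤ k := by positivity
    obtain ⟨K, hK, h⟩ := EE_bound hc (show -1 < α + k by linarith) p
    have h0 : 0 < p + (α + k) := by linarith
    have hcont : ContinuousAt (fun x : ℝ => K * (x ^ (p + (α+k)) * exp (-(c/2) * x))) 0 := by
      have := Real.continuousAt_rpow_const 0 (p + (α+k)) (Or.inr h0.le)
      fun_prop
    have h2 := hcont.tendsto
    simp only [Real.zero_rpow h0.ne', zero_mul, mul_zero] at h2
    refine squeeze_zero_norm' ?_ (h2.mono_left nhdsWithin_le_nhds)
    filter_upwards [self_mem_nhdsWithin] with x hx using h x hx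
  | zero => simp
  | add f g _ _ hf hg => simpa [mul_add] using hf.add hg
  | smul a f _ hf => simpa [mul_left_comm] using hf.const_mul a

lemma ibp (n : ℕ) {α c s : ℝ} (hα : -1 < α) (hc : 0 < c) (hsα : 0 < s + α) :
    ∫ x in Ioi (0 : ℝ), x ^ (s - 1) * Qt (n+1) α c x =
      -(s-1) * ∫ x in Ioi (0 : ℝ), x ^ (s - 1 - 1) * Qt n (α+1) c x := by
  obtain ⟨f, hf, h⟩ := Qt_mem n c (α+1) (by linarith)
  obtain ⟨f', hf', h'⟩ := VV_deriv hα hf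
  have e : ∀ x, 0 < x → Qt (n+1) α c x = f' x := fun x hx => by
    rw [Qt_succ, ← (h' x hx).deriv]
    apply Filter.EventuallyEq.deriv_eq
    filter_upwards [Ioi_mem_nhds hx] with y hy using h y hy
  have key := integral_Ioi_mul_deriv_eq_deriv_mul (a := 0) (u := fun x : ℝ => x ^ (s-1))
    (u' := fun x => (s-1) * x ^ (s-1-1)) (v := f) (v' := f') (a' := 0) (b' := 0)
    (fun x hx => Real.hasDerivAt_rpow_const (Or.inl (ne_of_gt hx))) (fun x hx => h' x hx)
    (VV_int hc hα (by linarith) hf')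
    (by
      have := (VV_int hc (by linarith) (p := s-1-1) (by linarith) hf).const_mul (s-1)
      refine Integrable.congr this (ae_of_all _ fun x => ?_)
      simp [mul_assoc])
    (VV_zero hc (by linarith) (by linarith) hf) (VV_top hc (by linarith) hf)
  rw [setIntegral_congr_fun (g := fun x => x ^ (s-1) * f' x) measurableSet_Ioi
    (fun x hx => by simp only [e x hx]),
    setIntegral_congr_fun (g := fun x => x ^ (s-1-1) * f x) (f := fun x => x ^ (s-1-1) * Qt n (α+1) c x) measurableSet_Ioi
    (fun x hx => by simp only [h x hx]), key]
  simp only [mul_assoc]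
  rw [integral_const_mul]; ring

lemma base {α c s : ℝ} (hα : -1 < α) (hc : 0 < c) (hsα : 0 < s + α) :
    ∫ x in Ioi (0 : ℝ), x ^ (s - 1) * EE c α x =
      Gamma (s+α) / (c ^ (s+α) * Gamma (α+1)) * hyp1F1 (s+α) (α+1) (1/c) := by
  set F : ℕ → ℝ → ℝ := fun i x => 1 / (Gamma (i + 1) * Gamma (α + i + 1)) *
    (x ^ (s + α + i - 1) * exp (-(c * x))) with hF
  have hpos : ∀ i : ℕ, 0 < Gamma (i + 1) * Gamma (α + i + 1) := fun i => by
    have hp := gam_pos hα i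
    have hp' := gam_pos (show (-1:ℝ) < 0 by norm_num) i
    rw [zero_add] at hp'
    positivity
  have hb : 0 < α + 1 := by linarith
  have hFi : ∀ i, IntegrableOn (F i) (Ioi 0) := fun i => by
    have := integrableOn_rpow_mul_exp_neg_mul_rpow (s := s + α + i - 1)
      (by have : (0:ℝ) ≤ i := by positivity
          linarith) one_pos hc
    simp only [Real.rpow_one, neg_mul] at this
    exact this.const_mul _
  have hFint : ∀ i, ∫ x in Ioi (0:ℝ), F i x = Gamma (s+α) / (c ^ (s+α) * Gamma (α+1)) *
      (risingFactorial (s+α) i * (1/c) ^ i / (risingFactorial (α+1) i * Nat.factorial i)) := fun i => by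
    simp only [hF]
    rw [integral_const_mul, Real.integral_rpow_mul_exp_neg_mul_Ioi (by positivity) hc, gamma_rf hsα,
      show α + i + 1 = α + 1 + i by ring, gamma_rf hb, Gamma_nat_eq_factorial,
      Real.rpow_add (by positivity), Real.rpow_natCast, Real.div_rpow zero_le_one hc.le, Real.one_rpow]
    have := rf_pos hb i
    have := Gamma_pos_of_pos hb
    field_simp
  have hnorm : ∀ i, ∫ x in Ioi (0:ℝ), ‖F i x‖ = ∫ x in Ioi (0:ℝ), F i x := fun i =>
    setIntegral_congr_fun measurableSet_Ioi fun x (hx : 0 < x) => by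
      have := hpos i
      exact norm_of_nonneg (by simp only [hF]; positivity)
  have key := integral_tsum_of_summable_integral_norm (μ := volume.restrict (Ioi (0:ℝ))) hFi
    (by simp only [hnorm, hFint]
        exact (hyp_summable _ hb _).mul_left _)
  simp only [hFint, tsum_mul_left] at key
  unfold hyp1F1
  rw [key]
  apply setIntegral_congr_fun measurableSet_Ioi
  intro x (hx : 0 < x)
  simp only [EE, gser]
  rw [← mul_assoc, ← tsum_mul_left]
  apply tsum_congr
  intro i
  simp only [hF]
  rw [show s + α + i - 1 = (s - 1) + α + i by ring, Real.rpow_add hx, Real.rpow_add hx, Real.rpow_natCast, neg_mul]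
  ring

theorem Qt_mellin (n : ℕ) (α c s : ℝ) (hα : -1 < α) (hc : 0 < c) (hs : (n : ℝ) < s)
    (hsα : 0 < s + α) :
    ∫ x in Set.Ioi (0 : ℝ), x ^ (s - 1) * Qt n α c x =
      (-1) ^ n * Real.exp (1 / c) * Real.Gamma s * Real.Gamma (s + α) /
          (c ^ (s + α) * Real.Gamma ((n : ℝ) + α + 1) * Real.Gamma (s - n)) *
        hyp1F1 ((n : ℝ) - s + 1) (α + n + 1) (-1 / c) := by
  induction n generalizing α s with
  | zero =>
    rw [setIntegral_congr_fun (g := fun x => x ^ (s-1) * EE c α x) measurableSet_Ioi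
      (fun x hx => by simp [Qt, wBessel_eq _ _ hx]), base hα hc hsα, kummer _ (by linarith)]
    have hs' : 0 < s := by simpa using hs
    have := Gamma_pos_of_pos hs'
    simp only [Nat.cast_zero, pow_zero, zero_add, sub_zero, add_zero, zero_sub]
    rw [show α + 1 - (s + α) = -s + 1 by ring, show -(1/c) = -1/c by ring]
    field_simp
  | succ n ih =>
    push_cast at hs ⊢
    have hn : (0:ℝ) ≤ n := by positivity
    have h1 : 0 < s - 1 := by linarith
    rw [ibp n hα hc hsα, ih (α+1) (s-1) (by linarith) (by linarith) (by linarith)]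
    rw [show s - 1 + (α + 1) = s + α by ring, show (n:ℝ) + (α+1) + 1 = n + 1 + α + 1 by ring,
      show s - 1 - (n:ℝ) = s - (n+1) by ring, show (n:ℝ) - (s-1) + 1 = n + 1 - s + 1 by ring,
      show α + 1 + (n:ℝ) + 1 = α + (n + 1) + 1 by ring]
    have hg : Gamma s = (s-1) * Gamma (s-1) := by
      rw [← Gamma_add_one h1.ne', sub_add_cancel]
    rw [hg]; ring
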